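/- arXiv:2207.06331 — 2 statements merged into one kernel-verified Lean document; each statement's English description precedes it below -/
import Mathlib

section
/- For every fixed x ≥ 0, the map α ↦ R_α(x) is strictly increasing on [0, ∞) and tends to infinity as α → ∞. -/
/-- The Macdonald function (modified Bessel function of the second kind):
`K_ν(x) = (x^ν / 2^(ν+1)) ∫_0^∞ exp(−t − x²/(4t)) t^(−ν−1) dt` for `x > 0`. -/
noncomputable def besselK (ν x : ℝ) : ℝ :=
  x ^ ν / 2 ^ (ν + 1) *
    ∫ t in Set.Ioi (0 : ℝ), Real.exp (-t - x ^ 2 / (4 * t)) * t ^ (-ν - 1)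

/-- `R_α(x) = α + x·K_{1−α}(x)/K_α(x)` for `x > 0`, and `R_α(0) = α`. -/
noncomputable def besselR (α x : ℝ) : ℝ :=
  if x = 0 then α else α + x * besselK (1 - α) x / besselK α x

open MeasureTheory Set Filter

/-- The weight `exp (-x cosh u)` times an exponential is integrable on the real line. -/
lemma integrable_exp_neg_mul_cosh_mul_exp {x : ℝ} (hx : 0 < x) (s : ℝ) :
    Integrable (fun u : ℝ => Real.exp (-x * Real.cosh u) * Real.exp (s * u)) := by
  have hg : Integrable (fun u : ℝ =>
      Real.exp (s ^ 2 / x) * Real.exp (-(x / 4) * u ^ 2)) :=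
    (integrable_exp_neg_mul_sq (by positivity)).const_mul _
  refine hg.mono' (by fun_prop) (ae_of_all _ fun u => ?_)
  rw [Real.norm_eq_abs, abs_of_pos (by positivity), ← Real.exp_add, ← Real.exp_add]
  apply Real.exp_le_exp.mpr
  have hc : 1 + u ^ 2 / 2 ≤ Real.cosh u := by
    have hdouble : Real.cosh u = 1 + 2 * Real.sinh (u / 2) ^ 2 := by
      rw [← mul_div_cancel₀ u (two_ne_zero' ℝ), Real.cosh_two_mul, Real.cosh_sq,
        mul_div_cancel₀ u (two_ne_zero' ℝ)]
      ring
    have hsinh : (u / 2) ^ 2 ≤ Real.sinh (u / 2) ^ 2 := by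
      rw [sq_le_sq, Real.abs_sinh]
      exact Real.self_le_sinh_iff.mpr (abs_nonneg _)
    linarith
  have hsq : 0 ≤ (s - x * u / 2) ^ 2 / x := by positivity
  have hexp : (s - x * u / 2) ^ 2 / x = s ^ 2 / x - s * u + x / 4 * u ^ 2 := by
    field_simp
    ring
  nlinarith

lemma integrable_exp_neg_mul_cosh_mul_cosh {x : ℝ} (hx : 0 < x) (s : ℝ) :
    Integrable (fun u : ℝ => Real.exp (-x * Real.cosh u) * Real.cosh (s * u)) := by
  convert ((integrable_exp_neg_mul_cosh_mul_exp hx s).add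
    (integrable_exp_neg_mul_cosh_mul_exp hx (-s))).div_const 2 using 2 with u
  rw [Real.cosh_eq (s * u)]
  simp only [Pi.add_apply, neg_mul]
  ring

lemma integrable_exp_neg_mul_cosh_mul_sinh {x : ℝ} (hx : 0 < x) (s : ℝ) :
    Integrable (fun u : ℝ => Real.exp (-x * Real.cosh u) * Real.sinh (s * u)) := by
  convert ((integrable_exp_neg_mul_cosh_mul_exp hx s).sub
    (integrable_exp_neg_mul_cosh_mul_exp hx (-s))).div_const 2 using 2 with u
  rw [Real.sinh_eq]
  simp only [Pi.sub_apply, neg_mul]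
  ring

lemma integrable_exp_neg_mul_cosh_mul_cosh_mul_cosh {x : ℝ} (hx : 0 < x) (s : ℝ) :
    Integrable (fun u : ℝ =>
      Real.exp (-x * Real.cosh u) * (Real.cosh u * Real.cosh (s * u))) := by
  convert ((integrable_exp_neg_mul_cosh_mul_cosh hx (s + 1)).add
    (integrable_exp_neg_mul_cosh_mul_cosh hx (s - 1))).div_const 2 using 2 with u
  simp only [Pi.add_apply, add_mul, sub_mul, one_mul, Real.cosh_add, Real.cosh_sub]
  ring

lemma integrable_exp_neg_mul_cosh_mul_sinh_mul_sinh {x : ℝ} (hx : 0 < x) (s : ℝ) :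
    Integrable (fun u : ℝ =>
      Real.exp (-x * Real.cosh u) * (Real.sinh u * Real.sinh (s * u))) := by
  convert ((integrable_exp_neg_mul_cosh_mul_cosh hx (s + 1)).sub
    (integrable_exp_neg_mul_cosh_mul_cosh hx (s - 1))).div_const 2 using 2 with u
  simp only [Pi.sub_apply, add_mul, sub_mul, one_mul, Real.cosh_add, Real.cosh_sub]
  ring

/-- The Laplace-type representation of the Macdonald function. -/
lemma besselK_eq_integral_exp {x : ℝ} (hx : 0 < x) (ν : ℝ) :
    besselK ν x = (∫ u : ℝ, Real.exp (-x * Real.cosh u) * Real.exp (-ν * u)) / 2 := by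
  have himg : (fun u : ℝ => x / 2 * Real.exp u) '' univ = Ioi 0 := by
    ext t
    simp only [image_univ, mem_range, mem_Ioi]
    constructor
    · rintro ⟨u, rfl⟩
      positivity
    · intro ht
      refine ⟨Real.log (t / (x / 2)), ?_⟩
      rw [Real.exp_log (by positivity)]
      field_simp
  have hinj : InjOn (fun u : ℝ => x / 2 * Real.exp u) univ := fun a _ b _ hab =>
    Real.exp_injective (mul_left_cancel₀ (by positivity) hab)
  have hcv := integral_image_eq_integral_abs_deriv_smul MeasurableSet.univ
    (fun u _ => ((Real.hasDerivAt_exp u).const_mul (x / 2)).hasDerivWithinAt) hinj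
    (fun t : ℝ => Real.exp (-t - x ^ 2 / (4 * t)) * t ^ (-ν - 1))
  rw [himg, Measure.restrict_univ] at hcv
  have hpt : ∀ u : ℝ, |x / 2 * Real.exp u| • (Real.exp (-(x / 2 * Real.exp u) -
      x ^ 2 / (4 * (x / 2 * Real.exp u))) * (x / 2 * Real.exp u) ^ (-ν - 1)) =
      (x / 2) ^ (-ν) * (Real.exp (-x * Real.cosh u) * Real.exp (-ν * u)) := by
    intro u
    have ht : 0 < x / 2 * Real.exp u := by positivity
    have harg : -(x / 2 * Real.exp u) - x ^ 2 / (4 * (x / 2 * Real.exp u)) =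
        -x * Real.cosh u := by
      rw [Real.cosh_eq, Real.exp_neg]
      field_simp
      ring
    rw [harg, abs_of_pos ht, smul_eq_mul, Real.rpow_sub_one ht.ne',
      Real.mul_rpow (by positivity) (by positivity), ← Real.exp_mul, mul_comm u]
    field_simp
  simp only [hpt] at hcv
  rw [besselK, hcv, integral_const_mul, Real.rpow_neg (by positivity),
    Real.div_rpow hx.le (by norm_num), Real.rpow_add_one (by norm_num)]
  have h1 : 0 < x ^ ν := by positivity
  have h2 : (0 : ℝ) < 2 ^ ν := by positivity
  field_simp

lemma besselK_eq_integral_cosh {x : ℝ} (hx : 0 < x) (ν : ℝ) :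
    besselK ν x = (∫ u : ℝ, Real.exp (-x * Real.cosh u) * Real.cosh (ν * u)) / 2 := by
  have hneg := integral_neg_eq_self
    (fun u : ℝ => Real.exp (-x * Real.cosh u) * Real.exp (-ν * u)) volume
  simp only [Real.cosh_neg, mul_neg, neg_mul, neg_neg] at hneg
  have hsplit : ∀ u : ℝ, Real.exp (-x * Real.cosh u) * Real.cosh (ν * u) =
      (Real.exp (-x * Real.cosh u) * Real.exp (ν * u)) / 2 +
      (Real.exp (-x * Real.cosh u) * Real.exp (-ν * u)) / 2 := by
    intro u
    rw [Real.cosh_eq (ν * u), neg_mul ν]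
    ring
  rw [besselK_eq_integral_exp hx]
  simp only [hsplit]
  rw [integral_add ((integrable_exp_neg_mul_cosh_mul_exp hx ν).div_const 2)
    ((integrable_exp_neg_mul_cosh_mul_exp hx (-ν)).div_const 2),
    integral_div, integral_div]
  simp only [neg_mul, hneg]
  ring

lemma integral_exp_neg_mul_cosh_mul_cosh_pos {x : ℝ} (hx : 0 < x) (s : ℝ) :
    0 < ∫ u : ℝ, Real.exp (-x * Real.cosh u) * Real.cosh (s * u) :=
  integral_pos_of_integrable_nonneg_nonzero (x := 0) (by fun_prop)
    (integrable_exp_neg_mul_cosh_mul_cosh hx s) (fun u => by positivity) (by positivity)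

lemma besselK_pos {x : ℝ} (hx : 0 < x) (ν : ℝ) : 0 < besselK ν x := by
  rw [besselK_eq_integral_cosh hx]
  exact half_pos (integral_exp_neg_mul_cosh_mul_cosh_pos hx ν)

/-- Integration by parts of `exp (-x cosh u) * sinh (s u)`. -/
lemma integral_exp_neg_mul_cosh_mul_sinh_mul_sinh {x : ℝ} (hx : 0 < x) (s : ℝ) :
    x * ∫ u : ℝ, Real.exp (-x * Real.cosh u) * (Real.sinh u * Real.sinh (s * u)) =
      s * ∫ u : ℝ, Real.exp (-x * Real.cosh u) * Real.cosh (s * u) := by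
  have hd : ∀ u : ℝ, HasDerivAt (fun u => Real.exp (-x * Real.cosh u) * Real.sinh (s * u))
      (s * (Real.exp (-x * Real.cosh u) * Real.cosh (s * u)) -
        x * (Real.exp (-x * Real.cosh u) * (Real.sinh u * Real.sinh (s * u)))) u := by
    intro u
    refine ((((Real.hasDerivAt_cosh u).const_mul (-x)).exp).mul
      (((hasDerivAt_id' u).const_mul s).sinh)).congr_deriv ?_
    ring
  have hi₁ := (integrable_exp_neg_mul_cosh_mul_cosh hx s).const_mul s
  have hi₂ := (integrable_exp_neg_mul_cosh_mul_sinh_mul_sinh hx s).const_mul x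
  have h := integral_eq_zero_of_hasDerivAt_of_integrable hd (hi₁.sub hi₂)
    (integrable_exp_neg_mul_cosh_mul_sinh hx s)
  rw [integral_sub hi₁ hi₂, integral_const_mul, integral_const_mul] at h
  linarith

/-- `R_α(x)` is `x` times the mean of `cosh u` under the weight `exp (-x cosh u) cosh (α u)`. -/
lemma besselR_eq_integral_div {x : ℝ} (hx : 0 < x) (α : ℝ) :
    besselR α x =
      x * ((∫ u : ℝ, Real.exp (-x * Real.cosh u) * (Real.cosh u * Real.cosh (α * u))) /
        ∫ u : ℝ, Real.exp (-x * Real.cosh u) * Real.cosh (α * u)) := by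
  have hpos := integral_exp_neg_mul_cosh_mul_cosh_pos hx α
  have hsplit : ∀ u : ℝ, Real.exp (-x * Real.cosh u) * Real.cosh ((1 - α) * u) =
      Real.exp (-x * Real.cosh u) * (Real.cosh u * Real.cosh (α * u)) -
      Real.exp (-x * Real.cosh u) * (Real.sinh u * Real.sinh (α * u)) := by
    intro u
    rw [sub_mul, one_mul, Real.cosh_sub]
    ring
  rw [besselR, if_neg hx.ne', besselK_eq_integral_cosh hx, besselK_eq_integral_cosh hx]
  simp only [hsplit]
  rw [integral_sub (integrable_exp_neg_mul_cosh_mul_cosh_mul_cosh hx α)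
    (integrable_exp_neg_mul_cosh_mul_sinh_mul_sinh hx α)]
  have hparts := integral_exp_neg_mul_cosh_mul_sinh_mul_sinh hx α
  generalize (∫ u : ℝ, Real.exp (-x * Real.cosh u) * Real.cosh (α * u)) = A at hpos hparts ⊢
  generalize (∫ u : ℝ, Real.exp (-x * Real.cosh u) * (Real.sinh u * Real.sinh (α * u))) = S
    at hparts ⊢
  field_simp
  linarith

/-- For `0 ≤ α < β`, the ratio `cosh (β u) / cosh (α u)` is strictly increasing in `u ≥ 0`. -/
lemma cosh_mul_cosh_lt_cosh_mul_cosh {α β u v : ℝ} (hα : 0 ≤ α) (hαβ : α < β)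
    (hv : 0 ≤ v) (huv : v < u) :
    Real.cosh (α * u) * Real.cosh (β * v) < Real.cosh (β * u) * Real.cosh (α * v) := by
  have h₁ : 0 < (β - α) * (u - v) := mul_pos (sub_pos.mpr hαβ) (sub_pos.mpr huv)
  have h₂ : 0 < (β - α) * (u + v) := mul_pos (sub_pos.mpr hαβ) (by linarith)
  have h₃ : 0 < (β + α) * (u - v) := mul_pos (by linarith) (sub_pos.mpr huv)
  have hu : 0 ≤ u := hv.trans huv.le
  have hadd : Real.cosh (α * u + β * v) < Real.cosh (β * u + α * v) := by
    have hβ : 0 ≤ β := hα.trans hαβ.le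
    rw [Real.cosh_lt_cosh, abs_of_nonneg (by positivity), abs_of_nonneg (by positivity)]
    linarith
  have hsub : Real.cosh (α * u - β * v) < Real.cosh (β * u - α * v) := by
    rw [Real.cosh_lt_cosh]
    exact (abs_lt.mpr ⟨by linarith, by linarith⟩).trans_le (le_abs_self _)
  rw [Real.cosh_add, Real.cosh_add] at hadd
  rw [Real.cosh_sub, Real.cosh_sub] at hsub
  linarith

/-- `cosh u` and `cosh (β u) / cosh (α u)` are similarly ordered. -/
lemma cosh_sub_cosh_mul_pos {α β u v : ℝ} (hα : 0 ≤ α) (hαβ : α < β) (huv : |u| ≠ |v|) :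
    0 < (Real.cosh u - Real.cosh v) *
      (Real.cosh (β * u) * Real.cosh (α * v) - Real.cosh (α * u) * Real.cosh (β * v)) := by
  have habs : ∀ s w : ℝ, Real.cosh (s * |w|) = Real.cosh (s * w) := by
    intro s w
    rcases abs_choice w with h | h <;> simp [h]
  rcases lt_or_gt_of_ne huv with h | h
  · have hlt := cosh_mul_cosh_lt_cosh_mul_cosh hα hαβ (abs_nonneg u) h
    simp only [habs] at hlt
    exact mul_pos_of_neg_of_neg (sub_neg.mpr (Real.cosh_lt_cosh.mpr h)) (by linarith)
  · have hlt := cosh_mul_cosh_lt_cosh_mul_cosh hα hαβ (abs_nonneg v) h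
    simp only [habs] at hlt
    exact mul_pos (sub_pos.mpr (Real.cosh_lt_cosh.mpr h)) (by linarith)

lemma besselR_lt_besselR {x α β : ℝ} (hx : 0 < x) (hα : 0 ≤ α) (hαβ : α < β) :
    besselR α x < besselR β x := by
  rw [besselR_eq_integral_div hx, besselR_eq_integral_div hx]
  have iα := integrable_exp_neg_mul_cosh_mul_cosh hx α
  have iβ := integrable_exp_neg_mul_cosh_mul_cosh hx β
  have jα := integrable_exp_neg_mul_cosh_mul_cosh_mul_cosh hx α
  have jβ := integrable_exp_neg_mul_cosh_mul_cosh_mul_cosh hx β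
  have pα := integral_exp_neg_mul_cosh_mul_cosh_pos hx α
  have pβ := integral_exp_neg_mul_cosh_mul_cosh_pos hx β
  set A := ∫ u : ℝ, Real.exp (-x * Real.cosh u) * Real.cosh (α * u)
  set B := ∫ u : ℝ, Real.exp (-x * Real.cosh u) * Real.cosh (β * u)
  set A₁ := ∫ u : ℝ, Real.exp (-x * Real.cosh u) * (Real.cosh u * Real.cosh (α * u)) with hA₁
  set B₁ := ∫ u : ℝ, Real.exp (-x * Real.cosh u) * (Real.cosh u * Real.cosh (β * u)) with hB₁
  have hmean : 1 ≤ A₁ / A := by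
    rw [one_le_div pα]
    refine integral_mono iα jα fun u => ?_
    have h1 := Real.one_le_cosh u
    have h2 := Real.cosh_pos (α * u)
    dsimp only
    gcongr
    nlinarith
  obtain ⟨v, hv⟩ : ∃ v, Real.cosh v = A₁ / A := ⟨_, Real.cosh_arcosh hmean⟩
  have hfun : ∀ u : ℝ, Real.exp (-x * Real.cosh u) * ((Real.cosh u - Real.cosh v) *
      (Real.cosh (β * u) * Real.cosh (α * v) - Real.cosh (α * u) * Real.cosh (β * v))) =
      Real.cosh (α * v) * (Real.exp (-x * Real.cosh u) * (Real.cosh u * Real.cosh (β * u)) -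
        Real.cosh v * (Real.exp (-x * Real.cosh u) * Real.cosh (β * u))) -
      Real.cosh (β * v) * (Real.exp (-x * Real.cosh u) * (Real.cosh u * Real.cosh (α * u)) -
        Real.cosh v * (Real.exp (-x * Real.cosh u) * Real.cosh (α * u))) := fun u => by ring
  have kβ := (jβ.sub (iβ.const_mul (Real.cosh v))).const_mul (Real.cosh (α * v))
  have kα := (jα.sub (iα.const_mul (Real.cosh v))).const_mul (Real.cosh (β * v))
  simp only [Pi.sub_apply] at kα kβ
  have hpos : 0 < ∫ u : ℝ, Real.exp (-x * Real.cosh u) * ((Real.cosh u - Real.cosh v) *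
      (Real.cosh (β * u) * Real.cosh (α * v) - Real.cosh (α * u) * Real.cosh (β * v))) := by
    refine integral_pos_of_integrable_nonneg_nonzero (x := |v| + 1) (by fun_prop) ?_
      (fun u => mul_nonneg (Real.exp_pos _).le ?_) (mul_pos (Real.exp_pos _) ?_).ne'
    · simp only [hfun]
      exact kβ.sub kα
    · by_cases huv : |u| = |v|
      · rw [← Real.cosh_abs u, ← Real.cosh_abs v, huv, sub_self, zero_mul]
      · exact (cosh_sub_cosh_mul_pos hα hαβ huv).le
    · refine cosh_sub_cosh_mul_pos hα hαβ ?_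
      rw [abs_of_nonneg (by positivity)]
      linarith
  simp only [hfun] at hpos
  rw [integral_sub kβ kα, integral_const_mul, integral_const_mul,
    integral_sub jβ (iβ.const_mul _), integral_sub jα (iα.const_mul _),
    integral_const_mul, integral_const_mul, ← hA₁, ← hB₁, hv, div_mul_cancel₀ _ pα.ne',
    sub_self, mul_zero, sub_zero] at hpos
  have hlt := pos_of_mul_pos_right hpos (Real.cosh_pos _).le
  refine mul_lt_mul_of_pos_left ((lt_div_iff₀ pβ).mpr ?_) hx
  linarith

/-- For every fixed `x ≥ 0`, the map `α ↦ R_α(x)` is strictly increasing on `[0, ∞)`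
and tends to infinity as `α → ∞`. -/
theorem besselR_strictMono_in_index (x : ℝ) (hx : 0 ≤ x) :
    StrictMonoOn (fun α => besselR α x) (Set.Ici 0) ∧
    Filter.Tendsto (fun α => besselR α x) Filter.atTop Filter.atTop := by
  rcases hx.eq_or_lt with rfl | hx
  · simp only [besselR, if_true]
    exact ⟨strictMono_id.strictMonoOn _, tendsto_id⟩
  · refine ⟨fun α hα β _ hαβ => besselR_lt_besselR hx hα hαβ,
      tendsto_atTop_mono (fun α => ?_) tendsto_id⟩
    have h₁ := besselK_pos hx (1 - α)
    have h₂ := besselK_pos hx α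
    rw [besselR, if_neg hx.ne', id]
    exact le_add_of_nonneg_right (by positivity)
end

section
/- As α ↘ 0, the functions x ↦ 1/\hat K_α(x) converge to x ↦ 1/K_0(x) uniformly on every compact subset of [0, ∞), where \hat K_α(0) := 2^{α−1}Γ(α) for α > 0 and 1/K_0(0) := 0. -/
/-- `\hat K_α(x) = x^α K_α(x)` for `x > 0`, extended by `\hat K_α(0) = 2^(α−1) Γ(α)`. -/
noncomputable def hatK (α x : ℝ) : ℝ :=
  if x = 0 then 2 ^ (α - 1) * Real.Gamma α else x ^ α * besselK α x

open Set Filter Topology MeasureTheory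

/-- The integrand `exp(−s − x²/(4s)) s^(α−1)` of the representation
`\hat K_α(x) = 2^(α−1) ∫_0^∞ exp(−s − x²/(4s)) s^(α−1) ds`. -/
noncomputable def hatKIntegrand (α x s : ℝ) : ℝ :=
  Real.exp (-s - x ^ 2 / (4 * s)) * s ^ (α - 1)

/-- The integral `∫_0^∞ exp(−s − x²/(4s)) s^(α−1) ds`. -/
noncomputable def hatKIntegral (α x : ℝ) : ℝ :=
  ∫ s in Ioi (0 : ℝ), hatKIntegrand α x s

lemma hatKIntegrand_pos (α x : ℝ) {s : ℝ} (hs : 0 < s) : 0 < hatKIntegrand α x s :=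
  mul_pos (Real.exp_pos _) (Real.rpow_pos_of_pos hs _)

lemma continuousOn_hatKIntegrand (α x : ℝ) : ContinuousOn (hatKIntegrand α x) (Ioi 0) := by
  intro s hs
  have hs : 0 < s := hs
  unfold hatKIntegrand
  refine ContinuousAt.continuousWithinAt ?_
  refine ContinuousAt.mul ?_ (Real.continuousAt_rpow_const _ _ (Or.inl hs.ne'))
  refine Real.continuous_exp.continuousAt.comp ?_
  refine ContinuousAt.sub (by fun_prop)
    (ContinuousAt.div (by fun_prop) (by fun_prop) (by positivity))

lemma aestronglyMeasurable_hatKIntegrand (α x : ℝ) :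
    AEStronglyMeasurable (hatKIntegrand α x) (volume.restrict (Ioi 0)) :=
  (continuousOn_hatKIntegrand α x).aestronglyMeasurable measurableSet_Ioi

lemma hatKIntegrand_le_gamma (α x : ℝ) {s : ℝ} (hs : 0 < s) :
    hatKIntegrand α x s ≤ Real.exp (-s) * s ^ (α - 1) := by
  unfold hatKIntegrand
  gcongr
  have : 0 ≤ x ^ 2 / (4 * s) := by positivity
  linarith

lemma hatKIntegrand_le_gamma_succ (α : ℝ) {x s : ℝ} (hx : 0 < x) (hs : 0 < s) :
    hatKIntegrand α x s ≤ 4 / x ^ 2 * (Real.exp (-s) * s ^ (α + 1 - 1)) := by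
  have hc : 0 < x ^ 2 / (4 * s) := by positivity
  have h1 : Real.exp (-(x ^ 2 / (4 * s))) ≤ 4 * s / x ^ 2 := by
    rw [Real.exp_neg, ← inv_div (x ^ 2)]
    gcongr
    linarith [Real.add_one_le_exp (x ^ 2 / (4 * s))]
  have h2 : s ^ (α + 1 - 1) = s * s ^ (α - 1) := by
    rw [show α + 1 - 1 = 1 + (α - 1) by ring, Real.rpow_add hs, Real.rpow_one]
  calc hatKIntegrand α x s
      = Real.exp (-s) * Real.exp (-(x ^ 2 / (4 * s))) * s ^ (α - 1) := by
        rw [hatKIntegrand, ← Real.exp_add, sub_eq_add_neg]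
    _ ≤ Real.exp (-s) * (4 * s / x ^ 2) * s ^ (α - 1) := by gcongr
    _ = _ := by rw [h2]; ring

lemma integrableOn_hatKIntegrand {α x : ℝ} (hα : 0 ≤ α) (h : 0 < α ∨ 0 < x) :
    IntegrableOn (hatKIntegrand α x) (Ioi 0) := by
  have key : ∀ g : ℝ → ℝ, IntegrableOn g (Ioi 0) → (∀ s, 0 < s → hatKIntegrand α x s ≤ g s) →
      IntegrableOn (hatKIntegrand α x) (Ioi 0) := by
    intro g hg hle
    refine Integrable.mono' hg (aestronglyMeasurable_hatKIntegrand α x) ?_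
    filter_upwards [ae_restrict_mem measurableSet_Ioi] with s hs
    rw [Real.norm_of_nonneg (hatKIntegrand_pos α x hs).le]
    exact hle s hs
  rcases h with h | h
  · exact key _ (Real.GammaIntegral_convergent h) fun s hs => hatKIntegrand_le_gamma α x hs
  · exact key _ ((Real.GammaIntegral_convergent (by linarith : 0 < α + 1)).const_mul (4 / x ^ 2))
      fun s hs => hatKIntegrand_le_gamma_succ α h hs

lemma hatKIntegral_pos {α x : ℝ} (hα : 0 ≤ α) (h : 0 < α ∨ 0 < x) :
    0 < hatKIntegral α x := by
  unfold hatKIntegral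
  rw [setIntegral_pos_iff_support_of_nonneg_ae _ (integrableOn_hatKIntegrand hα h)]
  · have : Function.support (hatKIntegrand α x) ∩ Ioi 0 = Ioi 0 :=
      inter_eq_right.2 fun s hs => (hatKIntegrand_pos α x hs).ne'
    simp [this]
  · filter_upwards [ae_restrict_mem measurableSet_Ioi] with s hs
    exact (hatKIntegrand_pos α x hs).le

lemma hatKIntegral_zero_zero : hatKIntegral 0 0 = 0 := by
  refine integral_undef fun h => ?_
  have h1 : IntegrableOn (hatKIntegrand 0 0) (Ioo 0 1) :=
    IntegrableOn.mono_set h Ioo_subset_Ioi_self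
  have h2 : IntegrableOn (fun s : ℝ => s ^ (-1 : ℝ)) (Ioo 0 1) := by
    refine Integrable.mono' (h1.const_mul (Real.exp 1)) (by fun_prop) ?_
    filter_upwards [ae_restrict_mem measurableSet_Ioo] with s hs
    have hp := Real.rpow_pos_of_pos hs.1 (-1)
    rw [Real.norm_of_nonneg hp.le, hatKIntegrand, ← mul_assoc, ← Real.exp_add, zero_sub]
    refine le_mul_of_one_le_left hp.le (Real.one_le_exp ?_)
    simpa using hs.2.le
  rw [intervalIntegral.integrableOn_Ioo_rpow_iff one_pos] at h2
  exact lt_irrefl _ h2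

lemma rpow_le_rpow_add_rpow {s a b c : ℝ} (hs : 0 < s) (hab : a ≤ b) (hbc : b ≤ c) :
    s ^ b ≤ s ^ a + s ^ c := by
  have ha := Real.rpow_pos_of_pos hs a
  have hc := Real.rpow_pos_of_pos hs c
  rcases le_total s 1 with h | h
  · linarith [Real.rpow_le_rpow_of_exponent_ge hs h hab]
  · linarith [Real.rpow_le_rpow_of_exponent_le h hbc]

lemma hatKIntegrand_le_add {a α b c x s : ℝ} (hs : 0 < s) (ha : a ≤ α) (hb : α ≤ b)
    (hc : 0 ≤ c) (hx : c ≤ x) :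
    hatKIntegrand α x s ≤ hatKIntegrand a c s + hatKIntegrand b c s := by
  unfold hatKIntegrand
  rw [← mul_add]
  gcongr
  exact rpow_le_rpow_add_rpow hs (by linarith) (by linarith)

lemma eventually_half_le_nhdsWithin_Ici {a : ℝ} (ha : 0 ≤ a) : ∀ᶠ y in 𝓝[Ici 0] a, a / 2 ≤ y := by
  rcases ha.eq_or_lt with rfl | h
  · filter_upwards [self_mem_nhdsWithin] with y hy
    simpa using hy
  · exact mem_nhdsWithin_of_mem_nhds (Ici_mem_nhds (by linarith))

lemma continuousWithinAt_hatKIntegral {α x : ℝ} (hα : 0 ≤ α) (hx : 0 ≤ x) (h : 0 < α ∨ 0 < x) :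
    ContinuousWithinAt (fun p : ℝ × ℝ => hatKIntegral p.1 p.2) (Ici 0 ×ˢ Ici 0) (α, x) := by
  have hfst : Tendsto Prod.fst (𝓝[Ici 0 ×ˢ Ici 0] (α, x)) (𝓝[Ici 0] α) := by
    rw [nhdsWithin_prod_eq]; exact tendsto_fst
  have hsnd : Tendsto Prod.snd (𝓝[Ici 0 ×ˢ Ici 0] (α, x)) (𝓝[Ici 0] x) := by
    rw [nhdsWithin_prod_eq]; exact tendsto_snd
  have h' : 0 < α / 2 ∨ 0 < x / 2 := h.imp half_pos half_pos
  have hint := (integrableOn_hatKIntegrand (by linarith : 0 ≤ α / 2) h').add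
    (integrableOn_hatKIntegrand (x := x / 2) (by linarith : 0 ≤ α + 1) (Or.inl (by linarith)))
  refine continuousWithinAt_of_dominated (Eventually.of_forall fun p =>
    aestronglyMeasurable_hatKIntegrand p.1 p.2) ?_ hint ?_
  · filter_upwards [hfst.eventually (eventually_half_le_nhdsWithin_Ici hα),
      hsnd.eventually (eventually_half_le_nhdsWithin_Ici hx),
      hfst.eventually (mem_nhdsWithin_of_mem_nhds (Iic_mem_nhds (lt_add_one α)))] with p h1 h2 h3
    filter_upwards [ae_restrict_mem measurableSet_Ioi] with s hs
    rw [Real.norm_of_nonneg (hatKIntegrand_pos _ _ hs).le]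
    exact hatKIntegrand_le_add hs h1 h3 (by linarith) h2
  · filter_upwards [ae_restrict_mem measurableSet_Ioi] with s hs
    have hs : 0 < s := hs
    refine Continuous.continuousWithinAt ?_
    unfold hatKIntegrand
    exact (by fun_prop : Continuous fun p : ℝ × ℝ => Real.exp (-s - p.2 ^ 2 / (4 * s))).mul
      (Continuous.rpow (by fun_prop) (by fun_prop) fun p => Or.inl hs.ne')

lemma le_hatKIntegral {α x δ : ℝ} (hδ : 0 < δ) (hδ1 : δ ≤ 1) (hα : 0 ≤ α) (hx : 0 ≤ x)
    (h : 0 < α ∨ 0 < x) (hxδ : x ≤ δ) (hαδ : 1 / 2 ≤ δ ^ α) :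
    Real.exp (-2) / 2 * -Real.log δ ≤ hatKIntegral α x := by
  have hI := integrableOn_hatKIntegrand hα h
  have hsub : Ioc δ 1 ⊆ Ioi 0 := fun s hs => hδ.trans hs.1
  have hinv : IntegrableOn (fun s : ℝ => s⁻¹) (Ioc δ 1) :=
    (intervalIntegrable_iff_integrableOn_Ioc_of_le hδ1).1
      (intervalIntegrable_inv_iff.2 (Or.inr (by
        rw [uIcc_of_le hδ1]; exact fun h0 => absurd h0.1 (not_le.2 hδ))))
  calc Real.exp (-2) / 2 * -Real.log δ
      = ∫ s in Ioc δ 1, Real.exp (-2) / 2 * s⁻¹ := by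
        rw [integral_const_mul, ← intervalIntegral.integral_of_le hδ1,
          integral_inv_of_pos hδ one_pos, one_div, Real.log_inv]
    _ ≤ ∫ s in Ioc δ 1, hatKIntegrand α x s := by
        refine setIntegral_mono_on (hinv.const_mul _) (hI.mono_set hsub) measurableSet_Ioc ?_
        intro s hs
        have hs0 : 0 < s := hsub hs
        have h1 : s ^ (α - 1) = s ^ α * s⁻¹ := by
          rw [Real.rpow_sub hs0, Real.rpow_one, div_eq_mul_inv]
        have h2 : 1 / 2 ≤ s ^ α := hαδ.trans (Real.rpow_le_rpow hδ.le hs.1.le hα)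
        have h3 : x ^ 2 / (4 * s) ≤ 1 := by
          rw [div_le_one (by positivity)]
          nlinarith [hs.1, hs.2]
        rw [hatKIntegrand, h1, div_eq_mul_one_div, mul_assoc]
        gcongr
        linarith [hs.2]
    _ ≤ hatKIntegral α x := by
        refine setIntegral_mono_set hI ?_ hsub.eventuallyLE
        filter_upwards [ae_restrict_mem measurableSet_Ioi] with s hs
        exact (hatKIntegrand_pos α x hs).le

lemma continuousWithinAt_hatKIntegral_inv_zero :
    ContinuousWithinAt (fun p : ℝ × ℝ => (hatKIntegral p.1 p.2)⁻¹) (Ici 0 ×ˢ Ici 0) (0, 0) := by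
  rw [← continuousWithinAt_sdiff_self]
  unfold ContinuousWithinAt
  simp only [hatKIntegral_zero_zero, inv_zero]
  refine tendsto_inv_atTop_zero.comp (tendsto_atTop.2 fun M => ?_)
  obtain ⟨n, hn⟩ := exists_nat_ge (M / (Real.exp (-2) / 2))
  set δ := Real.exp (-n) with hδ
  have hM : M ≤ Real.exp (-2) / 2 * -Real.log δ := by
    rw [div_le_iff₀ (by positivity)] at hn
    rw [hδ, Real.log_exp, neg_neg]
    linarith
  have hδ0 : 0 < δ := Real.exp_pos _
  have h1 : ∀ᶠ p : ℝ × ℝ in 𝓝 (0, 0), p.2 < δ :=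
    continuousAt_snd.eventually_lt continuousAt_const hδ0
  have h2 : ∀ᶠ p : ℝ × ℝ in 𝓝 (0, 0), 1 / 2 < δ ^ p.1 := by
    have hc : Continuous fun p : ℝ × ℝ => δ ^ p.1 :=
      continuous_const.rpow continuous_fst fun _ => Or.inl hδ0.ne'
    refine continuousAt_const.eventually_lt hc.continuousAt ?_
    norm_num
  filter_upwards [mem_nhdsWithin_of_mem_nhds h1, mem_nhdsWithin_of_mem_nhds h2,
    self_mem_nhdsWithin] with p hp1 hp2 hp
  obtain ⟨⟨ha, hx⟩, hne⟩ := hp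
  have ha : 0 ≤ p.1 := ha
  have hx : 0 ≤ p.2 := hx
  have hor : 0 < p.1 ∨ 0 < p.2 := by
    by_contra! hcon
    exact hne (Prod.ext (le_antisymm hcon.1 ha) (le_antisymm hcon.2 hx))
  exact hM.trans (le_hatKIntegral hδ0 (Real.exp_le_one_iff.2 (by simp)) ha hx hor hp1.le hp2.le)

lemma continuousOn_hatKIntegral_inv :
    ContinuousOn (fun p : ℝ × ℝ => (hatKIntegral p.1 p.2)⁻¹) (Ici 0 ×ˢ Ici 0) := by
  rintro ⟨α, x⟩ ⟨hα, hx⟩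
  have hα : 0 ≤ α := hα
  have hx : 0 ≤ x := hx
  by_cases h : 0 < α ∨ 0 < x
  · exact (continuousWithinAt_hatKIntegral hα hx h).inv₀ (hatKIntegral_pos hα h).ne'
  · push Not at h
    obtain rfl := le_antisymm h.1 hα
    obtain rfl := le_antisymm h.2 hx
    exact continuousWithinAt_hatKIntegral_inv_zero

lemma besselK_zero_eq (x : ℝ) : besselK 0 x = 2 ^ ((0 : ℝ) - 1) * hatKIntegral 0 x := by
  simp [besselK, hatKIntegral, hatKIntegrand, Real.rpow_neg_one]

/-- The substitution `t = c / s`. -/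
lemma integral_exp_neg_sub_div_mul_rpow {c : ℝ} (hc : 0 < c) (α : ℝ) :
    ∫ t in Ioi (0 : ℝ), Real.exp (-t - c / t) * t ^ (-α - 1) =
      c ^ (-α) * ∫ s in Ioi (0 : ℝ), Real.exp (-s - c / s) * s ^ (α - 1) := by
  have h1 := integral_comp_mul_left_Ioi
    (fun t => Real.exp (-t - c / t) * t ^ (-α - 1)) 0 hc
  have h2 := integral_comp_rpow_Ioi
    (fun u => Real.exp (-(c * u) - c / (c * u)) * (c * u) ^ (-α - 1)) (p := -1) (by norm_num)
  rw [mul_zero, smul_eq_mul, eq_inv_mul_iff_mul_eq₀ hc.ne'] at h1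
  rw [← h1, ← h2, ← integral_const_mul, ← integral_const_mul]
  refine setIntegral_congr_fun measurableSet_Ioi fun s hs => ?_
  have hs : 0 < s := hs
  have e1 : (c * s⁻¹) ^ (-α - 1) = c ^ (-α) * c⁻¹ * s ^ (α + 1) := by
    rw [Real.mul_rpow hc.le (by positivity), Real.inv_rpow hs.le, ← Real.rpow_neg hs.le,
      Real.rpow_sub hc, Real.rpow_one, div_eq_mul_inv]
    congr 2
    ring
  have e2 : s ^ (α - 1) = s ^ (-1 - 1 : ℝ) * s ^ (α + 1) := by
    rw [← Real.rpow_add hs]; congr 1; ring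
  have e3 : -(c * s⁻¹) - c / (c * s⁻¹) = -s - c / s := by
    field_simp
    ring
  simp only [Real.rpow_neg_one, smul_eq_mul, e1, e2, e3, abs_neg, abs_one]
  field_simp

lemma hatK_eq {α x : ℝ} (hα : 0 < α) (hx : 0 ≤ x) :
    hatK α x = 2 ^ (α - 1) * hatKIntegral α x := by
  unfold hatK
  split_ifs with h
  · subst h
    simp [hatKIntegral, hatKIntegrand, Real.Gamma_eq_integral hα]
  · have hx : 0 < x := lt_of_le_of_ne hx (Ne.symm h)
    have hsub := integral_exp_neg_sub_div_mul_rpow (c := x ^ 2 / 4) (by positivity) α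
    simp only [div_div] at hsub
    rw [besselK, hsub, hatKIntegral]
    unfold hatKIntegrand
    have e1 : (x ^ 2 / 4) ^ (-α) = (2 ^ α * 2 ^ α) / (x ^ α * x ^ α) := by
      rw [show x ^ 2 / 4 = (x * x) / (2 * 2) by ring, Real.rpow_neg (by positivity),
        Real.div_rpow (by positivity) (by positivity), Real.mul_rpow hx.le hx.le,
        Real.mul_rpow (by norm_num) (by norm_num), inv_div]
    have hxα := Real.rpow_pos_of_pos hx α
    rw [e1, Real.rpow_add two_pos, Real.rpow_sub two_pos, Real.rpow_one]
    generalize ∫ s in Ioi (0 : ℝ), Real.exp (-s - x ^ 2 / (4 * s)) * s ^ (α - 1) = I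
    field_simp

/-- As `α ↘ 0`, the functions `x ↦ 1/\hat K_α(x)` converge to `x ↦ 1/K_0(x)`
(with `1/K_0(0) := 0`) uniformly on every compact subset of `[0, ∞)`. -/
theorem hatK_inv_tendstoUniformlyOn (s : Set ℝ) (hs : IsCompact s) (hsub : s ⊆ Set.Ici 0) :
    TendstoUniformlyOn (fun α x => (hatK α x)⁻¹)
      (fun x => if x = 0 then 0 else (besselK 0 x)⁻¹)
      (nhdsWithin 0 (Set.Ioi 0)) s := by
  let F : ℝ → ℝ → ℝ := fun α x => (2 ^ (α - 1) * hatKIntegral α x)⁻¹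
  have hF : ContinuousOn (Function.uncurry F) (Ici 0 ×ˢ s) := by
    have h2 : Continuous fun p : ℝ × ℝ => ((2 : ℝ) ^ (p.1 - 1))⁻¹ :=
      (Continuous.rpow (by fun_prop) (by fun_prop) fun _ => Or.inl two_ne_zero).inv₀
        fun _ => (Real.rpow_pos_of_pos two_pos _).ne'
    refine (h2.continuousOn.mul (continuousOn_hatKIntegral_inv.mono
      (prod_mono_right hsub))).congr fun p _ => ?_
    simp [F, Function.uncurry, mul_comm]
  have hlim : ∀ x, F 0 x = if x = 0 then 0 else (besselK 0 x)⁻¹ := by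
    intro x
    split_ifs with h
    · simp [F, h, hatKIntegral_zero_zero]
    · rw [besselK_zero_eq]
  intro u hu
  obtain ⟨v, hv, hvu⟩ := hs.mem_uniformity_of_prod hF (mem_Ici.2 le_rfl) (symm_le_uniformity hu)
  filter_upwards [nhdsWithin_mono _ Ioi_subset_Ici_self hv, self_mem_nhdsWithin] with α hα hα0 x hx
  have := hvu α hα x hx
  rw [hlim] at this
  rw [hatK_eq hα0 (hsub hx)]
  exact this
end
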